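/- arXiv:1708.09181 — 4 statements merged into one kernel-verified Lean document; each statement's English description precedes it below -/
import Mathlib

section
/- (Product formula for theta functions with characteristics.) Let n₁, n₂ ∈ ℤ be nonzero, let a₁, a₂ ∈ ℝ, and let z₁, z₂, τ ∈ ℂ with Im(n₁τ) > 0 and Im(n₂τ) > 0. Then θ[a₁/n₁;0](z₁, n₁τ) · θ[a₂/n₂;0](z₂, n₂τ) = Σ_{d=0}^{|n₁+n₂|−1} θ[(n₂a₁ − n₁a₂ + n₁n₂d)/(n₁n₂(n₁+n₂)); 0](n₂z₁ − n₁z₂, n₁n₂(n₁+n₂)τ) · θ[(a₁ + a₂ + n₁d)/(n₁+n₂); 0](z₁ + z₂, (n₁+n₂)τ). -/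
/-- The theta function with characteristics
`θ[a;b](z,τ) := Σ_{m∈ℤ} exp(πi(m+a)²τ + 2πi(m+a)(z+b))`. -/
noncomputable def theta (a : ℝ) (b z τ : ℂ) : ℂ :=
  ∑' m : ℤ, Complex.exp (Real.pi * Complex.I * ((m : ℂ) + (a : ℂ)) ^ 2 * τ +
    2 * Real.pi * Complex.I * ((m : ℂ) + (a : ℂ)) * (z + b))

/-- The series defining `theta a b z τ` converges absolutely for `τ` in the upper half plane. -/
lemma summable_norm_theta_term (a : ℝ) (b z : ℂ) {τ : ℂ} (hτ : 0 < τ.im) :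
    Summable fun m : ℤ ↦ ‖Complex.exp (Real.pi * Complex.I * ((m : ℂ) + (a : ℂ)) ^ 2 * τ +
      2 * Real.pi * Complex.I * ((m : ℂ) + (a : ℂ)) * (z + b))‖ := by
  have h := (((summable_jacobiTheta₂_term_iff (z + b + a * τ) τ).mpr hτ).mul_left
    (Complex.exp (Real.pi * Complex.I * (a : ℂ) ^ 2 * τ +
      2 * Real.pi * Complex.I * (a : ℂ) * (z + b)))).norm
  refine h.congr fun m ↦ ?_
  rw [jacobiTheta₂_term, ← Complex.exp_add]
  congr 2
  ring

/-- A product of two theta functions is an absolutely convergent double series. -/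
lemma hasSum_theta_mul_theta (a a' : ℝ) (b b' z z' : ℂ) {τ τ' : ℂ} (hτ : 0 < τ.im)
    (hτ' : 0 < τ'.im) :
    HasSum (fun p : ℤ × ℤ ↦ Complex.exp
      ((Real.pi * Complex.I * ((p.1 : ℂ) + (a : ℂ)) ^ 2 * τ +
        2 * Real.pi * Complex.I * ((p.1 : ℂ) + (a : ℂ)) * (z + b)) +
      (Real.pi * Complex.I * ((p.2 : ℂ) + (a' : ℂ)) ^ 2 * τ' +
        2 * Real.pi * Complex.I * ((p.2 : ℂ) + (a' : ℂ)) * (z' + b'))))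
      (theta a b z τ * theta a' b' z' τ') := by
  have h := summable_norm_theta_term a b z hτ
  have h' := summable_norm_theta_term a' b' z' hτ'
  simp_rw [Complex.exp_add (_ + _) (_ + _)]
  rw [theta, theta, tsum_mul_tsum_of_summable_norm h h']
  exact (summable_mul_of_summable_norm h h').hasSum

/-- The map `(d, k, l) ↦ (l + n₂ k + d, l - n₁ k)` is a bijection from
`{0, …, |n₁ + n₂| - 1} × ℤ × ℤ` to `ℤ × ℤ`. -/
lemma bijective_residue_prod (n₁ n₂ : ℤ) (hN : n₁ + n₂ ≠ 0) :
    Function.Bijective fun q : Fin (n₁ + n₂).natAbs × (ℤ × ℤ) ↦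
      ((q.2.2 + n₂ * q.2.1 + (q.1 : ℕ), q.2.2 - n₁ * q.2.1) : ℤ × ℤ) := by
  constructor
  · rintro ⟨d, k, l⟩ ⟨d', k', l'⟩ h
    simp only [Prod.mk.injEq] at h
    obtain ⟨h₁, h₂⟩ := h
    have hdiff : ((d : ℕ) : ℤ) + (n₁ + n₂) * k = (d' : ℕ) + (n₁ + n₂) * k' := by
      linear_combination h₁ - h₂
    have hmod (e : Fin (n₁ + n₂).natAbs) (j : ℤ) :
        ((e : ℕ) + (n₁ + n₂) * j) % (n₁ + n₂) = ((e : ℕ) : ℤ) := by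
      rw [Int.add_mul_emod_self_left, ← Int.emod_abs]
      exact Int.emod_eq_of_lt (Int.natCast_nonneg _) (by rw [Int.abs_eq_natAbs]; exact_mod_cast e.isLt)
    have hd : ((d : ℕ) : ℤ) = (d' : ℕ) := by rw [← hmod d k, hdiff, hmod]
    have hk : k = k' := mul_left_cancel₀ hN (by linear_combination hdiff - hd)
    subst hk
    have hl : l = l' := by linear_combination h₂
    have hd' : d = d' := Fin.ext (by exact_mod_cast hd)
    rw [hd', hl]
  · rintro ⟨m₁, m₂⟩
    have h0 := Int.emod_nonneg (m₁ - m₂) hN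
    have hlt := Int.emod_lt (m₁ - m₂) hN
    refine ⟨⟨⟨((m₁ - m₂) % (n₁ + n₂)).toNat, by omega⟩, (m₁ - m₂) / (n₁ + n₂),
      m₂ + n₁ * ((m₁ - m₂) / (n₁ + n₂))⟩, ?_⟩
    have hdm := Int.emod_add_mul_ediv (m₁ - m₂) (n₁ + n₂)
    simp only [Int.toNat_of_nonneg h0, Prod.mk.injEq]
    exact ⟨by linear_combination hdm, by ring⟩

/-- Product formula for theta functions with characteristics:
`θ[a₁/n₁;0](z₁,n₁τ) · θ[a₂/n₂;0](z₂,n₂τ)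
  = Σ_{d=0}^{|n₁+n₂|−1} θ[(n₂a₁−n₁a₂+n₁n₂d)/(n₁n₂(n₁+n₂));0](n₂z₁−n₁z₂, n₁n₂(n₁+n₂)τ)
      · θ[(a₁+a₂+n₁d)/(n₁+n₂);0](z₁+z₂, (n₁+n₂)τ)`. -/
theorem theta_product_formula (n₁ n₂ : ℤ) (h₁ : n₁ ≠ 0) (h₂ : n₂ ≠ 0) (a₁ a₂ : ℝ)
    (z₁ z₂ τ : ℂ) (hτ₁ : 0 < ((n₁ : ℂ) * τ).im) (hτ₂ : 0 < ((n₂ : ℂ) * τ).im) :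
    theta (a₁ / (n₁ : ℝ)) 0 z₁ ((n₁ : ℂ) * τ) * theta (a₂ / (n₂ : ℝ)) 0 z₂ ((n₂ : ℂ) * τ) =
      ∑ d ∈ Finset.range (n₁ + n₂).natAbs,
        theta (((n₂ : ℝ) * a₁ - (n₁ : ℝ) * a₂ + (n₁ : ℝ) * (n₂ : ℝ) * (d : ℝ)) /
            ((n₁ : ℝ) * (n₂ : ℝ) * ((n₁ : ℝ) + (n₂ : ℝ)))) 0
          ((n₂ : ℂ) * z₁ - (n₁ : ℂ) * z₂) ((n₁ : ℂ) * (n₂ : ℂ) * ((n₁ : ℂ) + (n₂ : ℂ)) * τ) *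
        theta ((a₁ + a₂ + (n₁ : ℝ) * (d : ℝ)) / ((n₁ : ℝ) + (n₂ : ℝ))) 0
          (z₁ + z₂) (((n₁ : ℂ) + (n₂ : ℂ)) * τ) := by
  have hN : 0 < (((n₁ : ℂ) + (n₂ : ℂ)) * τ).im := by
    rw [add_mul, Complex.add_im]
    exact add_pos hτ₁ hτ₂
  have hN₀ : n₁ + n₂ ≠ 0 := by
    intro h
    have h' : (n₁ : ℂ) + (n₂ : ℂ) = 0 := by exact_mod_cast h
    simp [h'] at hN
  have hP : 0 < ((n₁ : ℂ) * (n₂ : ℂ) * ((n₁ : ℂ) + (n₂ : ℂ)) * τ).im := by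
    have him (r : ℤ) : ((r : ℂ) * τ).im = r * τ.im := by
      simp [Complex.mul_im]
    have hcast : (n₁ : ℂ) + (n₂ : ℂ) = ((n₁ + n₂ : ℤ) : ℂ) := by push_cast; rfl
    have hcast' : (n₁ : ℂ) * (n₂ : ℂ) * ((n₁ : ℂ) + (n₂ : ℂ)) =
        ((n₁ * n₂ * (n₁ + n₂) : ℤ) : ℂ) := by push_cast; rfl
    rw [hcast, him] at hN
    rw [him] at hτ₁ hτ₂
    rw [hcast', him]
    refine pos_of_mul_pos_left (b := τ.im ^ 2) ?_ (sq_nonneg _)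
    have := mul_pos (mul_pos hτ₁ hτ₂) hN
    push_cast at this ⊢
    linarith
  have hL := hasSum_theta_mul_theta (a₁ / (n₁ : ℝ)) (a₂ / (n₂ : ℝ)) 0 0 z₁ z₂ hτ₁ hτ₂
  rw [← (Equiv.ofBijective _ (bijective_residue_prod n₁ n₂ hN₀)).hasSum_iff] at hL
  rw [Finset.sum_range]
  refine (hL.prod_fiberwise fun d ↦ ?_).unique (hasSum_fintype _)
  have hR := hasSum_theta_mul_theta
    (((n₂ : ℝ) * a₁ - (n₁ : ℝ) * a₂ + (n₁ : ℝ) * (n₂ : ℝ) * ((d : ℕ) : ℝ)) /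
      ((n₁ : ℝ) * (n₂ : ℝ) * ((n₁ : ℝ) + (n₂ : ℝ))))
    ((a₁ + a₂ + (n₁ : ℝ) * ((d : ℕ) : ℝ)) / ((n₁ : ℝ) + (n₂ : ℝ))) 0 0
    ((n₂ : ℂ) * z₁ - (n₁ : ℂ) * z₂) (z₁ + z₂) hP hN
  convert hR using 1
  funext p
  have h₁' : (n₁ : ℂ) ≠ 0 := by exact_mod_cast h₁
  have h₂' : (n₂ : ℂ) ≠ 0 := by exact_mod_cast h₂
  have hN' : (n₁ : ℂ) + (n₂ : ℂ) ≠ 0 := by exact_mod_cast hN₀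
  simp only [Function.comp_apply, Equiv.ofBijective_apply]
  push_cast
  congr 1
  generalize hV : (p.1 : ℂ) + (n₂ * a₁ - n₁ * a₂ + n₁ * n₂ * ((d : ℕ) : ℂ)) /
    (n₁ * n₂ * (n₁ + n₂)) = V
  generalize hW : (p.2 : ℂ) + (a₁ + a₂ + n₁ * ((d : ℕ) : ℂ)) / (n₁ + n₂) = W
  have hu₁ : (p.2 : ℂ) + n₂ * p.1 + ((d : ℕ) : ℂ) + a₁ / n₁ = n₂ * V + W := by
    rw [← hV, ← hW]
    field_simp
    ring
  have hu₂ : (p.2 : ℂ) - n₁ * p.1 + a₂ / n₂ = W - n₁ * V := by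
    rw [← hV, ← hW]
    field_simp
    ring
  rw [hu₁, hu₂]
  ring
end

section
/- Let n₁, n₂ ∈ ℤ be nonzero, a₁, a₂ ∈ ℝ, u₁, u₂, z, τ ∈ ℂ with Im(n₁τ) > 0 and Im(n₂τ) > 0. Then θ[a₁/n₁; u₁](n₁z, n₁τ) · θ[a₂/n₂; u₂](n₂z, n₂τ) = Σ_{d=0}^{|n₁+n₂|−1} θ[(n₂a₁ − n₁a₂ + n₁n₂d)/(n₁n₂(n₁+n₂)); n₂u₁ − n₁u₂](0, n₁n₂(n₁+n₂)τ) · θ[(a₁ + a₂ + n₁d)/(n₁+n₂); u₁ + u₂]((n₁+n₂)z, (n₁+n₂)τ). -/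
/-- The terms of the theta series are summable when `0 < τ.im`. -/
lemma summable_theta_term (a : ℝ) (b z : ℂ) {τ : ℂ} (hτ : 0 < τ.im) :
    Summable fun m : ℤ ↦ Complex.exp (Real.pi * Complex.I * ((m : ℂ) + (a : ℂ)) ^ 2 * τ +
      2 * Real.pi * Complex.I * ((m : ℂ) + (a : ℂ)) * (z + b)) := by
  have h := ((summable_jacobiTheta₂_term_iff (a * τ + z + b) τ).mpr hτ).mul_left
    (Complex.exp (Real.pi * Complex.I * a ^ 2 * τ + 2 * Real.pi * Complex.I * a * (z + b)))
  refine h.congr fun m ↦ ?_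
  rw [jacobiTheta₂_term, ← Complex.exp_add]
  ring_nf

/-- The product of two theta functions as a sum over pairs of integers. -/
lemma theta_mul_theta (a a' : ℝ) (b b' z z' : ℂ) {τ τ' : ℂ} (hτ : 0 < τ.im) (hτ' : 0 < τ'.im) :
    theta a b z τ * theta a' b' z' τ' = ∑' p : ℤ × ℤ,
      Complex.exp ((Real.pi * Complex.I * ((p.1 : ℂ) + (a : ℂ)) ^ 2 * τ +
        2 * Real.pi * Complex.I * ((p.1 : ℂ) + (a : ℂ)) * (z + b)) +
        (Real.pi * Complex.I * ((p.2 : ℂ) + (a' : ℂ)) ^ 2 * τ' +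
        2 * Real.pi * Complex.I * ((p.2 : ℂ) + (a' : ℂ)) * (z' + b'))) := by
  simp_rw [Complex.exp_add _ (_ + _)]
  exact tsum_mul_tsum_of_summable_norm (summable_theta_term a b z hτ).norm
    (summable_theta_term a' b' z' hτ').norm

/-- The pairs of integers `(m₁, m₂)`, parametrized by the residue `d` and the quotient `k` of
`m₁ - m₂` modulo `n₁ + n₂` together with `l = m₂ + n₁ * k`. -/
def intProdResidueEquiv (n₁ n₂ : ℤ) (h : n₁ + n₂ ≠ 0) :
    Fin (n₁ + n₂).natAbs × (ℤ × ℤ) ≃ ℤ × ℤ where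
  toFun q := (q.2.2 + n₂ * q.2.1 + (q.1 : ℕ), q.2.2 - n₁ * q.2.1)
  invFun p := (⟨((p.1 - p.2) % (n₁ + n₂)).toNat, by
      have := Int.emod_nonneg (p.1 - p.2) h
      have := Int.emod_lt_abs (p.1 - p.2) h
      rw [Int.abs_eq_natAbs] at this
      omega⟩, ((p.1 - p.2) / (n₁ + n₂), p.2 + n₁ * ((p.1 - p.2) / (n₁ + n₂))))
  left_inv := by
    rintro ⟨d, k, l⟩
    have hd : ((d : ℕ) : ℤ) < |n₁ + n₂| := by
      rw [Int.abs_eq_natAbs]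
      exact_mod_cast d.2
    have hsub : l + n₂ * k + (d : ℕ) - (l - n₁ * k) = (d : ℕ) + (n₁ + n₂) * k := by ring
    have hmod : ((d : ℕ) : ℤ) % (n₁ + n₂) = (d : ℕ) := by
      rw [← Int.emod_abs]
      exact Int.emod_eq_of_lt (by positivity) hd
    have hdiv : ((d : ℕ) : ℤ) / (n₁ + n₂) = 0 := by
      have := Int.mul_ediv_add_emod ((d : ℕ) : ℤ) (n₁ + n₂)
      rw [hmod] at this
      simpa [h] using this
    simp only [hsub, Int.add_mul_emod_self_left, Int.add_mul_ediv_left _ _ h, hmod, hdiv]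
    simp
  right_inv := by
    rintro ⟨m₁, m₂⟩
    have hnonneg := Int.emod_nonneg (m₁ - m₂) h
    have heq := Int.mul_ediv_add_emod (m₁ - m₂) (n₁ + n₂)
    simp only [Int.toNat_of_nonneg hnonneg, Prod.mk.injEq]
    constructor
    · linarith
    · ring

/-- Product formula for theta functions with characteristics and connections:
`θ[a₁/n₁;u₁](n₁z,n₁τ) · θ[a₂/n₂;u₂](n₂z,n₂τ)
  = Σ_{d=0}^{|n₁+n₂|−1}
      θ[(n₂a₁−n₁a₂+n₁n₂d)/(n₁n₂(n₁+n₂)); n₂u₁−n₁u₂](0, n₁n₂(n₁+n₂)τ)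
      · θ[(a₁+a₂+n₁d)/(n₁+n₂); u₁+u₂]((n₁+n₂)z, (n₁+n₂)τ)`. -/
theorem theta_product_formula_with_connections (n₁ n₂ : ℤ) (h₁ : n₁ ≠ 0) (h₂ : n₂ ≠ 0)
    (a₁ a₂ : ℝ) (u₁ u₂ z τ : ℂ)
    (hτ₁ : 0 < ((n₁ : ℂ) * τ).im) (hτ₂ : 0 < ((n₂ : ℂ) * τ).im) :
    theta (a₁ / (n₁ : ℝ)) u₁ ((n₁ : ℂ) * z) ((n₁ : ℂ) * τ) *
      theta (a₂ / (n₂ : ℝ)) u₂ ((n₂ : ℂ) * z) ((n₂ : ℂ) * τ) =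
      ∑ d ∈ Finset.range (n₁ + n₂).natAbs,
        theta (((n₂ : ℝ) * a₁ - (n₁ : ℝ) * a₂ + (n₁ : ℝ) * (n₂ : ℝ) * (d : ℝ)) /
            ((n₁ : ℝ) * (n₂ : ℝ) * ((n₁ : ℝ) + (n₂ : ℝ))))
          ((n₂ : ℂ) * u₁ - (n₁ : ℂ) * u₂) 0
          ((n₁ : ℂ) * (n₂ : ℂ) * ((n₁ : ℂ) + (n₂ : ℂ)) * τ) *
        theta ((a₁ + a₂ + (n₁ : ℝ) * (d : ℝ)) / ((n₁ : ℝ) + (n₂ : ℝ))) (u₁ + u₂)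
          (((n₁ : ℂ) + (n₂ : ℂ)) * z) (((n₁ : ℂ) + (n₂ : ℂ)) * τ) := by
  have him₁ : 0 < (n₁ : ℝ) * τ.im := by simpa using hτ₁
  have him₂ : 0 < (n₂ : ℝ) * τ.im := by simpa using hτ₂
  have himN : 0 < ((n₁ : ℝ) + n₂) * τ.im := by linarith
  have hτN : 0 < (((n₁ : ℂ) + (n₂ : ℂ)) * τ).im := by simpa using himN
  have hn₁n₂ : 0 < (n₁ : ℝ) * n₂ := by
    have := mul_pos him₁ him₂
    exact pos_of_mul_pos_left (by linarith : 0 < (n₁ : ℝ) * n₂ * τ.im ^ 2) (sq_nonneg _)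
  have hτP : 0 < ((n₁ : ℂ) * (n₂ : ℂ) * ((n₁ : ℂ) + (n₂ : ℂ)) * τ).im := by
    have hcast : (n₁ : ℂ) * (n₂ : ℂ) * ((n₁ : ℂ) + (n₂ : ℂ)) * τ =
        (((n₁ : ℝ) * n₂ * (n₁ + n₂) : ℝ) : ℂ) * τ := by push_cast; ring
    rw [hcast, Complex.im_ofReal_mul, mul_assoc]
    exact mul_pos hn₁n₂ himN
  have hN : n₁ + n₂ ≠ 0 := by
    rintro h
    have : (n₁ : ℝ) + n₂ = 0 := by exact_mod_cast h
    simp [this] at himN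
  have hNC : (n₁ : ℂ) + n₂ ≠ 0 := by exact_mod_cast hN
  have h₁C : (n₁ : ℂ) ≠ 0 := by exact_mod_cast h₁
  have h₂C : (n₂ : ℂ) ≠ 0 := by exact_mod_cast h₂
  have hsum := summable_mul_of_summable_norm
    (summable_theta_term (a₁ / (n₁ : ℝ)) u₁ ((n₁ : ℂ) * z) hτ₁).norm
    (summable_theta_term (a₂ / (n₂ : ℝ)) u₂ ((n₂ : ℂ) * z) hτ₂).norm
  simp_rw [← Complex.exp_add] at hsum
  have hsum' := (intProdResidueEquiv n₁ n₂ hN).summable_iff.mpr hsum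
  rw [theta_mul_theta _ _ _ _ _ _ hτ₁ hτ₂, ← (intProdResidueEquiv n₁ n₂ hN).tsum_eq]
  refine (Summable.tsum_prod hsum').trans ?_
  rw [tsum_fintype, Finset.sum_range]
  refine Finset.sum_congr rfl fun d _ ↦ ?_
  rw [theta_mul_theta _ _ _ _ _ _ hτP hτN]
  refine tsum_congr fun ⟨k, l⟩ ↦ congrArg Complex.exp ?_
  simp only [intProdResidueEquiv, Equiv.coe_fn_mk]
  push_cast
  field_simp
  ring
end

section
/- (Lemma: ℤ-indexed product expansion with connections.) Let n₁, n₂ ∈ ℤ be nonzero, a₁, a₂ ∈ ℝ, u₁, u₂, z, τ ∈ ℂ with Im(n₁τ) > 0 and Im(n₂τ) > 0. Then θ[a₁/n₁; u₁](n₁z, n₁τ) · θ[a₂/n₂; u₂](n₂z, n₂τ) = Σ_{α∈ℤ} exp( πiτ (n₂a₁ − n₁(a₂ − n₂α))² / (n₁n₂(n₁+n₂)) + 2πi · ((n₂a₁ − n₁(a₂ − n₂α)) / (n₁n₂(n₁+n₂))) · (n₂u₁ − n₁u₂) ) · θ[(a₁ + a₂ − n₂α)/(n₁+n₂); u₁ +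 u₂]((n₁+n₂)z, (n₁+n₂)τ). -/
/-- The `m`-th term of the series defining `theta`. -/
noncomputable def thetaTerm (a : ℝ) (b z τ : ℂ) (m : ℤ) : ℂ :=
  Complex.exp (Real.pi * Complex.I * ((m : ℂ) + (a : ℂ)) ^ 2 * τ +
    2 * Real.pi * Complex.I * ((m : ℂ) + (a : ℂ)) * (z + b))

lemma theta_eq_tsum_thetaTerm (a : ℝ) (b z τ : ℂ) :
    theta a b z τ = ∑' m : ℤ, thetaTerm a b z τ m := rfl

lemma thetaTerm_eq_mul_jacobiTheta₂_term (a : ℝ) (b z τ : ℂ) (m : ℤ) :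
    thetaTerm a b z τ m =
      Complex.exp (Real.pi * Complex.I * a ^ 2 * τ + 2 * Real.pi * Complex.I * a * (z + b)) *
        jacobiTheta₂_term m (a * τ + z + b) τ := by
  rw [thetaTerm, jacobiTheta₂_term, ← Complex.exp_add]
  ring_nf

lemma summable_thetaTerm (a : ℝ) (b z : ℂ) {τ : ℂ} (hτ : 0 < τ.im) :
    Summable (thetaTerm a b z τ) := by
  simp_rw [funext (thetaTerm_eq_mul_jacobiTheta₂_term a b z τ)]
  exact ((summable_jacobiTheta₂_term_iff _ τ).2 hτ).mul_left _

/-- The change of indices `(α, m) ↦ (m, m - α)` on `ℤ × ℤ`. -/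
def diffIndexEquiv : ℤ × ℤ ≃ ℤ × ℤ where
  toFun p := (p.2, p.2 - p.1)
  invFun q := (q.1 - q.2, q.1)
  left_inv p := by simp
  right_inv q := by simp

lemma thetaTerm_mul_thetaTerm {n₁ n₂ : ℤ} (h₁ : n₁ ≠ 0) (h₂ : n₂ ≠ 0) (h : n₁ + n₂ ≠ 0)
    (a₁ a₂ : ℝ) (u₁ u₂ z τ : ℂ) (α m : ℤ) :
    thetaTerm (a₁ / (n₁ : ℝ)) u₁ ((n₁ : ℂ) * z) ((n₁ : ℂ) * τ) m *
      thetaTerm (a₂ / (n₂ : ℝ)) u₂ ((n₂ : ℂ) * z) ((n₂ : ℂ) * τ) (m - α) =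
        Complex.exp ((Real.pi : ℂ) * Complex.I * τ *
            ((((n₂ : ℝ) * a₁ - (n₁ : ℝ) * (a₂ - (n₂ : ℝ) * (α : ℝ))) ^ 2 /
              ((n₁ : ℝ) * (n₂ : ℝ) * ((n₁ : ℝ) + (n₂ : ℝ))) : ℝ) : ℂ) +
          2 * (Real.pi : ℂ) * Complex.I *
            ((((n₂ : ℝ) * a₁ - (n₁ : ℝ) * (a₂ - (n₂ : ℝ) * (α : ℝ))) /
              ((n₁ : ℝ) * (n₂ : ℝ) * ((n₁ : ℝ) + (n₂ : ℝ))) : ℝ) : ℂ)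
          * ((n₂ : ℂ) * u₁ - (n₁ : ℂ) * u₂)) *
        thetaTerm ((a₁ + (a₂ - (n₂ : ℝ) * (α : ℝ))) / ((n₁ : ℝ) + (n₂ : ℝ))) (u₁ + u₂)
          (((n₁ : ℂ) + (n₂ : ℂ)) * z) (((n₁ : ℂ) + (n₂ : ℂ)) * τ) m := by
  have h₁' : (n₁ : ℂ) ≠ 0 := by exact_mod_cast h₁
  have h₂' : (n₂ : ℂ) ≠ 0 := by exact_mod_cast h₂
  have h' : (n₁ : ℂ) + n₂ ≠ 0 := by exact_mod_cast h
  simp only [thetaTerm]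
  rw [← Complex.exp_add, ← Complex.exp_add]
  congr 1
  push_cast
  field_simp
  ring

/-- ℤ-indexed product expansion with connections:
`θ[a₁/n₁;u₁](n₁z,n₁τ) · θ[a₂/n₂;u₂](n₂z,n₂τ)
  = Σ_{α∈ℤ} exp(πiτ(n₂a₁−n₁(a₂−n₂α))²/(n₁n₂(n₁+n₂))
              + 2πi((n₂a₁−n₁(a₂−n₂α))/(n₁n₂(n₁+n₂)))(n₂u₁−n₁u₂))
      · θ[(a₁+a₂−n₂α)/(n₁+n₂); u₁+u₂]((n₁+n₂)z, (n₁+n₂)τ)`. -/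
theorem theta_product_int_expansion (n₁ n₂ : ℤ) (h₁ : n₁ ≠ 0) (h₂ : n₂ ≠ 0)
    (a₁ a₂ : ℝ) (u₁ u₂ z τ : ℂ)
    (hτ₁ : 0 < ((n₁ : ℂ) * τ).im) (hτ₂ : 0 < ((n₂ : ℂ) * τ).im) :
    theta (a₁ / (n₁ : ℝ)) u₁ ((n₁ : ℂ) * z) ((n₁ : ℂ) * τ) *
      theta (a₂ / (n₂ : ℝ)) u₂ ((n₂ : ℂ) * z) ((n₂ : ℂ) * τ) =
      ∑' α : ℤ,
        Complex.exp ((Real.pi : ℂ) * Complex.I * τ *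
            ((((n₂ : ℝ) * a₁ - (n₁ : ℝ) * (a₂ - (n₂ : ℝ) * (α : ℝ))) ^ 2 /
              ((n₁ : ℝ) * (n₂ : ℝ) * ((n₁ : ℝ) + (n₂ : ℝ))) : ℝ) : ℂ) +
          2 * (Real.pi : ℂ) * Complex.I *
            ((((n₂ : ℝ) * a₁ - (n₁ : ℝ) * (a₂ - (n₂ : ℝ) * (α : ℝ))) /
              ((n₁ : ℝ) * (n₂ : ℝ) * ((n₁ : ℝ) + (n₂ : ℝ))) : ℝ) : ℂ)
          * ((n₂ : ℂ) * u₁ - (n₁ : ℂ) * u₂)) *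
        theta ((a₁ + (a₂ - (n₂ : ℝ) * (α : ℝ))) / ((n₁ : ℝ) + (n₂ : ℝ))) (u₁ + u₂)
          (((n₁ : ℂ) + (n₂ : ℂ)) * z) (((n₁ : ℂ) + (n₂ : ℂ)) * τ) := by
  have h : n₁ + n₂ ≠ 0 := by
    intro h
    have hsum : ((n₁ : ℂ) * τ).im + ((n₂ : ℂ) * τ).im = 0 := by
      rw [← Complex.add_im, ← add_mul, ← Int.cast_add, h]
      simp
    linarith
  have hs₁ := summable_thetaTerm (a₁ / (n₁ : ℝ)) u₁ ((n₁ : ℂ) * z) hτ₁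
  have hs₂ := summable_thetaTerm (a₂ / (n₂ : ℝ)) u₂ ((n₂ : ℂ) * z) hτ₂
  have hs := diffIndexEquiv.summable_iff.2 (summable_mul_of_summable_norm hs₁.norm hs₂.norm)
  simp only [theta_eq_tsum_thetaTerm]
  rw [tsum_mul_tsum_of_summable_norm hs₁.norm hs₂.norm, ← diffIndexEquiv.tsum_eq]
  refine hs.tsum_prod.trans (tsum_congr fun α ↦ ?_)
  rw [← tsum_mul_left]
  exact tsum_congr fun m ↦ thetaTerm_mul_thetaTerm h₁ h₂ h a₁ a₂ u₁ u₂ z τ α m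
end

section
/- (Recursion for S_d.) Let d ≥ 2 and 2 ≤ k ≤ d−1. Let n₀₁, …, n_{k,k+1} ∈ ℤ be nonzero with N_k := n₀₁ + ⋯ + n_{k−1,k} ≠ 0 and N_k + n_{k,k+1} ≠ 0, and let p₀₁, …, p_{k,k+1} ∈ ℝ. Then S_{k+1}(p₀₁, …, p_{k,k+1}) − S_k(p₀₁, …, p_{k−1,k}) = ( n_{k,k+1} · Σ_{i=1}^{k} n_{i−1,i} p_{i−1,i} − N_k · n_{k,k+1} p_{k,k+1} )² / ( 2 N_k · n_{k,k+1} · (N_k + n_{k,k+1}) ). -/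
/-- The quadratic form `S_d`: given integers `n 0, …, n (d-1)` (representing
`n_{0,1}, …, n_{d−1,d}`) and reals `p 0, …, p (d-1)`, with
`n_{0,d} = Σ n i` and `p_{0,d} = (Σ nᵢpᵢ)/n_{0,d}`,
`S_d(p) = (1/2)(Σ nᵢpᵢ(pᵢ−1) − n_{0,d} p_{0,d}(p_{0,d}−1))`. -/
noncomputable def Sform (d : ℕ) (n : ℕ → ℤ) (p : ℕ → ℝ) : ℝ :=
  (1 / 2) * ((∑ i ∈ Finset.range d, (n i : ℝ) * p i * (p i - 1)) -
    (∑ i ∈ Finset.range d, (n i : ℝ)) *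
      ((∑ i ∈ Finset.range d, (n i : ℝ) * p i) / (∑ i ∈ Finset.range d, (n i : ℝ))) *
      ((∑ i ∈ Finset.range d, (n i : ℝ) * p i) / (∑ i ∈ Finset.range d, (n i : ℝ)) - 1))

/-- Recursion for `S_d`: for `2 ≤ k ≤ d−1`, with `N_k = n₀₁ + ⋯ + n_{k−1,k}`,
`S_{k+1} − S_k = (n_{k,k+1} Σ_{i=1}^k n_{i−1,i}p_{i−1,i} − N_k n_{k,k+1} p_{k,k+1})²
                  / (2 N_k n_{k,k+1} (N_k + n_{k,k+1}))`.
Here `n i`, `p i` (for `0 ≤ i ≤ k`) represent `n_{i,i+1}`, `p_{i,i+1}`. -/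
theorem S_recursion (d k : ℕ) (hd : 2 ≤ d) (hk : 2 ≤ k) (hkd : k ≤ d - 1)
    (n : ℕ → ℤ) (p : ℕ → ℝ)
    (hn : ∀ i ≤ k, n i ≠ 0)
    (hN : (∑ i ∈ Finset.range k, n i) ≠ 0)
    (hNk : (∑ i ∈ Finset.range k, n i) + n k ≠ 0) :
    Sform (k + 1) n p - Sform k n p =
      ((n k : ℝ) * (∑ i ∈ Finset.range k, (n i : ℝ) * p i) -
          (∑ i ∈ Finset.range k, (n i : ℝ)) * ((n k : ℝ) * p k)) ^ 2 /
        (2 * (∑ i ∈ Finset.range k, (n i : ℝ)) * (n k : ℝ) *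
          ((∑ i ∈ Finset.range k, (n i : ℝ)) + (n k : ℝ))) := by
  have hm : (n k : ℝ) ≠ 0 := Int.cast_ne_zero.mpr (hn k le_rfl)
  have hN' : (∑ i ∈ Finset.range k, (n i : ℝ)) ≠ 0 := by exact_mod_cast hN
  have hNk' : (∑ i ∈ Finset.range k, (n i : ℝ)) + (n k : ℝ) ≠ 0 := by exact_mod_cast hNk
  simp only [Sform, Finset.sum_range_succ]
  generalize (∑ i ∈ Finset.range k, (n i : ℝ)) = N at *
  generalize (∑ i ∈ Finset.range k, (n i : ℝ) * p i) = A
  generalize (∑ i ∈ Finset.range k, (n i : ℝ) * p i * (p i - 1)) = B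
  field_simp
  ring
end
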